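/- Let Λ be a left and right noetherian ring and k a positive integer. The following are equivalent: (1) grade Ext^{i+1}_Λ(M,Λ) ≥ i for every M in mod Λ and every 1 ≤ i ≤ k−1; (2) Ext^{i−1}_Λ(Ext^{i+1}_Λ(M,Λ),Λ) = 0 for every M in mod Λ and every 1 ≤ i ≤ k−1; (3) Ω^i_Λ(mod Λ) = T^i_Λ(mod Λ) for every 1 ≤ i ≤ k; (1)^op grade Ext^{i+1}_Λ(N,Λ) ≥ i for every N in mod Λ^op and every 1 ≤ i ≤ k−1; (2)^op Ext^{i−1}_Λ(Ext^{i+1}_Λ(N,Λ),Λ) = 0 for every N in mod Λ^op and every 1 ≤ i ≤ k−1; (3)^op Ω^i_Λ(mod Λ^op) = T^i_Λ(mod Λ^op) for every 1 ≤ i ≤ k. -/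

import Mathlib

/-! Common definitions: concrete Ext groups (via the canonical free resolution) of a module
over a ring `R` with coefficients in an `(R,S)`-bimodule `U`, carrying their natural
`S`-module structure; grades, Gorenstein conditions, resolution dimensions, etc. -/

noncomputable section

namespace GorPaper

section Ext

variable (R : Type) [Ring R]

/-- The canonical free cover `R^(M) → M` of a module. -/
def cover (M : Type) [AddCommGroup M] [Module R M] : (M →₀ R) →ₗ[R] M :=
  Finsupp.linearCombination R (_root_.id : M → M)

/-- The syzygy modules of `M` along its canonical free resolution:
`syz R M 0 = M` and `syz R M (n+1) = ker (R^(syz R M n) → syz R M n)`. -/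
def syz (M : ModuleCat.{0} R) : ℕ → ModuleCat.{0} R
  | 0 => M
  | n + 1 => ModuleCat.of R (LinearMap.ker (cover R (syz M n)))

variable {R} in
/-- Functoriality of the free cover. -/
def freeMap {M N : Type} [AddCommGroup M] [Module R M] [AddCommGroup N] [Module R N]
    (f : M →ₗ[R] N) : (M →₀ R) →ₗ[R] (N →₀ R) :=
  Finsupp.lmapDomain R R f

lemma cover_comp_freeMap {M N : Type} [AddCommGroup M] [Module R M] [AddCommGroup N]
    [Module R N] (f : M →ₗ[R] N) : (cover R N).comp (freeMap f) = f.comp (cover R M) := by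
  ext a
  simp [cover, freeMap, Finsupp.linearCombination_single]

lemma freeMap_ker {M N : Type} [AddCommGroup M] [Module R M] [AddCommGroup N] [Module R N]
    (f : M →ₗ[R] N) :
    ∀ x ∈ LinearMap.ker (cover R M), freeMap f x ∈ LinearMap.ker (cover R N) := by
  intro x hx
  have := congrArg (fun g => g x) (cover_comp_freeMap R f)
  simp only [LinearMap.comp_apply] at this
  simp only [LinearMap.mem_ker] at hx ⊢
  rw [this, hx, map_zero]

variable {R} in
/-- The induced map on first syzygies. -/
def kerMap {M N : Type} [AddCommGroup M] [Module R M] [AddCommGroup N] [Module R N]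
    (f : M →ₗ[R] N) :
    ↥(LinearMap.ker (cover R M)) →ₗ[R] ↥(LinearMap.ker (cover R N)) :=
  (freeMap f).restrict (freeMap_ker R f)

variable {R} in
/-- The induced map on `n`-th syzygies. -/
def syzMap {M N : ModuleCat.{0} R} (f : ↥M →ₗ[R] ↥N) :
    ∀ n, ↥(syz R M n) →ₗ[R] ↥(syz R N n)
  | 0 => f
  | n + 1 => kerMap (syzMap f n)

variable (S : Type) [Ring S]
variable (U : Type) [AddCommGroup U] [Module R U] [Module S U] [SMulCommClass R S U]

/-- Precomposition `Hom_R(B,U) → Hom_R(A,U)`, as an `S`-linear map (where the `S`-module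
structures come from the right `S`-structure of the bimodule `U`). -/
def precompS {A B : Type} [AddCommMonoid A] [Module R A] [AddCommMonoid B] [Module R B]
    (t : A →ₗ[R] B) : (B →ₗ[R] U) →ₗ[S] (A →ₗ[R] U) where
  toFun g := g.comp t
  map_add' g h := LinearMap.add_comp _ _ _
  map_smul' s g := LinearMap.smul_comp _ _ _

/-- The submodule of `Hom_R(Ω N, U)` consisting of those homomorphisms which extend to
the free cover of `N`. -/
def ext1Sub (N : Type) [AddCommGroup N] [Module R N] :
    Submodule S (↥(LinearMap.ker (cover R N)) →ₗ[R] U) :=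
  LinearMap.range (precompS R S U (LinearMap.ker (cover R N)).subtype)

/-- `Ext¹_R(N, U)`, as an `S`-module. -/
def Ext1 (N : Type) [AddCommGroup N] [Module R N] : Type :=
  (↥(LinearMap.ker (cover R N)) →ₗ[R] U) ⧸ ext1Sub R S U N

instance (N : Type) [AddCommGroup N] [Module R N] : AddCommGroup (Ext1 R S U N) :=
  inferInstanceAs (AddCommGroup (_ ⧸ ext1Sub R S U N))

instance (N : Type) [AddCommGroup N] [Module R N] : Module S (Ext1 R S U N) :=
  inferInstanceAs (Module S (_ ⧸ ext1Sub R S U N))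

/-- `Ext^n_R(M, U)`, as an `S`-module: `Ext⁰ = Hom_R(M,U)` and
`Ext^{n+1}(M,U) = Ext¹(Ω^n M, U)` (dimension shifting along the canonical free
resolution of `M`). -/
def ExtU (M : ModuleCat.{0} R) : ℕ → Type
  | 0 => ↥M →ₗ[R] U
  | n + 1 => Ext1 R S U ↥(syz R M n)

instance (M : ModuleCat.{0} R) (n : ℕ) : AddCommGroup (ExtU R S U M n) :=
  match n with
  | 0 => inferInstanceAs (AddCommGroup (↥M →ₗ[R] U))
  | n + 1 => inferInstanceAs (AddCommGroup (Ext1 R S U ↥(syz R M n)))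

instance (M : ModuleCat.{0} R) (n : ℕ) : Module S (ExtU R S U M n) :=
  match n with
  | 0 => inferInstanceAs (Module S (↥M →ₗ[R] U))
  | n + 1 => inferInstanceAs (Module S (Ext1 R S U ↥(syz R M n)))

lemma ext1Sub_le_comap {M N : Type} [AddCommGroup M] [Module R M] [AddCommGroup N]
    [Module R N] (f : M →ₗ[R] N) :
    ext1Sub R S U N ≤ (ext1Sub R S U M).comap (precompS R S U (kerMap f)) := by
  rintro g ⟨h, rfl⟩
  exact ⟨precompS R S U (freeMap f) h, LinearMap.ext fun x => rfl⟩

variable {R} in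
/-- Contravariant functoriality of `Ext¹`. -/
def ext1Map {M N : Type} [AddCommGroup M] [Module R M] [AddCommGroup N] [Module R N]
    (f : M →ₗ[R] N) : Ext1 R S U N →ₗ[S] Ext1 R S U M :=
  Submodule.mapQ _ _ (precompS R S U (kerMap f)) (ext1Sub_le_comap R S U f)

variable {R} in
/-- Contravariant functoriality of `Ext^n`: the map
`Ext^n_R(N,U) → Ext^n_R(M,U)` induced by `f : M → N`; it is `S`-linear. -/
def extMap {M N : ModuleCat.{0} R} (f : ↥M →ₗ[R] ↥N) :
    ∀ n, ExtU R S U N n →ₗ[S] ExtU R S U M n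
  | 0 => precompS R S U f
  | n + 1 => ext1Map S U (syzMap f n)

/-- `Ext^n_R(M,U) = 0`. -/
def extVanish (M : ModuleCat.{0} R) (n : ℕ) : Prop :=
  Subsingleton (ExtU R S U M n)

/-- `grade_U M ≥ i` : `Ext^j_R(M,U) = 0` for all `j < i`. -/
def gradeGE (M : ModuleCat.{0} R) (i : ℕ) : Prop :=
  ∀ j < i, extVanish R S U M j

/-- `grade_U M = g` : `grade_U M ≥ g` and `Ext^g_R(M,U) ≠ 0`. -/
def gradeEq (M : ModuleCat.{0} R) (g : ℕ) : Prop :=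
  gradeGE R S U M g ∧ ¬ extVanish R S U M g

/-- `s.grade_U M ≥ i` : `grade_U B ≥ i` for every submodule `B` of `M`. -/
def sgradeGE (M : ModuleCat.{0} R) (i : ℕ) : Prop :=
  ∀ B : Submodule R ↥M, gradeGE R S U (ModuleCat.of R ↥B) i

/-- Membership in `H_g` : `grade_U M = g` and `Ext^i(M,U) = 0` for all `i ≠ g`. -/
def Hmem (M : ModuleCat.{0} R) (g : ℕ) : Prop :=
  gradeEq R S U M g ∧ ∀ i, i ≠ g → extVanish R S U M i

/-- The functor `Ext^i_S(Ext^i_R(-,U),U) : mod R → mod R` preserves monomorphisms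
(on finitely generated modules). -/
def ExtExtMono [SMulCommClass S R U] (i : ℕ) : Prop :=
  ∀ (X Y : ModuleCat.{0} R), Module.Finite R ↥X → Module.Finite R ↥Y →
    ∀ f : ↥X →ₗ[R] ↥Y, Function.Injective f →
      Function.Injective
        (extMap (R := S) (S := R) U
          (M := ModuleCat.of S (ExtU R S U Y i)) (N := ModuleCat.of S (ExtU R S U X i))
          (extMap (S := S) U f i) i)

/-- `M` is `U`-`k`-torsionfree: for (every) finitely generated projective presentation
`P₁ → P₀ → M → 0`, with `X = coker (Hom(P₀,U) → Hom(P₁,U))`, one has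
`Ext^i_S(X, U) = 0` for `1 ≤ i ≤ k`. -/
def Torsionfree [SMulCommClass S R U] (k : ℕ) (M : ModuleCat.{0} R) : Prop :=
  ∀ (P₁ P₀ : ModuleCat.{0} R), Module.Finite R ↥P₁ → Module.Projective R ↥P₁ →
    Module.Finite R ↥P₀ → Module.Projective R ↥P₀ →
    ∀ (f : ↥P₁ →ₗ[R] ↥P₀) (g : ↥P₀ →ₗ[R] ↥M), Function.Surjective g →
      LinearMap.range f = LinearMap.ker g →
      ∀ i, 1 ≤ i → i ≤ k →
        extVanish S R U
          (ModuleCat.of S ((↥P₁ →ₗ[R] U) ⧸ LinearMap.range (precompS R S U f))) i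

end Ext

section Resol

variable (R : Type) [Ring R] (U : Type) [AddCommGroup U] [Module R U]

/-- `A` belongs to `add U`: it is (isomorphic to) a direct summand of a finite direct
sum of copies of `U`. -/
def InAdd (A : ModuleCat.{0} R) : Prop :=
  ∃ (m : ℕ) (i : ↥A →ₗ[R] (Fin m → U)) (p : (Fin m → U) →ₗ[R] ↥A),
    p.comp i = LinearMap.id

/-- `U`-resolution dimension of `A` is at most `n` : there is an exact sequence
`0 → U_n → ⋯ → U_0 → A → 0` with all `U_i` in `add U`. -/
def URdimLE : ℕ → ModuleCat.{0} R → Prop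
  | 0, A => InAdd R U A
  | n + 1, A => ∃ V : ModuleCat.{0} R, InAdd R U V ∧
      ∃ g : ↥V →ₗ[R] ↥A, Function.Surjective g ∧
        URdimLE n (ModuleCat.of R ↥(LinearMap.ker g))

/-- The `U`-resolution dimension of `A`, as an element of `ℕ∞`. -/
def URdim (A : ModuleCat.{0} R) : ℕ∞ :=
  sInf {c : ℕ∞ | ∃ n : ℕ, c = n ∧ URdimLE R U n A}

/-- `M` is a `k`-syzygy module: there is an exact sequence
`0 → M → P_{k-1} → ⋯ → P_0 → X → 0` with all `P_i` finitely generated projective. -/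
def IsSyzygy : ℕ → ModuleCat.{0} R → Prop
  | 0, _ => True
  | k + 1, M => ∃ P : ModuleCat.{0} R, Module.Finite R ↥P ∧ Module.Projective R ↥P ∧
      ∃ f : ↥M →ₗ[R] ↥P, Function.Injective f ∧
        IsSyzygy k (ModuleCat.of R (↥P ⧸ LinearMap.range f))

/-- `M` is a `U`-`k`-syzygy module: there is an exact sequence
`0 → M → X_0 → X_1 → ⋯ → X_{k-1}` with all `X_i` in `add U`. -/
def IsUSyzygy : ℕ → ModuleCat.{0} R → Prop
  | 0, _ => True
  | k + 1, M => ∃ V : ModuleCat.{0} R, InAdd R U V ∧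
      ∃ f : ↥M →ₗ[R] ↥V, Function.Injective f ∧
        IsUSyzygy k (ModuleCat.of R (↥V ⧸ LinearMap.range f))

/-- The injective dimension of `A` is at most `n` : there is an injective resolution
`0 → A → E_0 → ⋯ → E_n → 0`. -/
def injDimLE : ℕ → ModuleCat.{0} R → Prop
  | 0, A => Module.Injective R ↥A
  | n + 1, A => ∃ E : ModuleCat.{0} R, Module.Injective R ↥E ∧
      ∃ f : ↥A →ₗ[R] ↥E, Function.Injective f ∧
        injDimLE n (ModuleCat.of R (↥E ⧸ LinearMap.range f))

/-- The injective dimension of `A`, as an element of `ℕ∞`. -/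
def injDim (A : ModuleCat.{0} R) : ℕ∞ :=
  sInf {c : ℕ∞ | ∃ n : ℕ, c = n ∧ injDimLE R n A}

/-- `A` is a flat `R`-module (equational criterion for flatness, which makes sense
over an arbitrary, possibly noncommutative, ring): every relation in `A` can be
trivialized. -/
def IsFlat (A : Type) [AddCommGroup A] [Module R A] : Prop :=
  ∀ (n : ℕ) (a : Fin n → R) (x : Fin n → A), (∑ i, a i • x i) = 0 →
    ∃ (k : ℕ) (b : Fin n → Fin k → R) (y : Fin k → A),
      (∀ i, x i = ∑ j, b i j • y j) ∧ ∀ j, (∑ i, a i * b i j) = 0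

/-- The flat dimension of `A` is at most `n` : there is a flat resolution
`0 → F_n → ⋯ → F_0 → A → 0`. -/
def flatDimLE : ℕ → ModuleCat.{0} R → Prop
  | 0, A => IsFlat R ↥A
  | n + 1, A => ∃ F : ModuleCat.{0} R, IsFlat R ↥F ∧
      ∃ g : ↥F →ₗ[R] ↥A, Function.Surjective g ∧
        flatDimLE n (ModuleCat.of R ↥(LinearMap.ker g))

/-- `A` is cogenerated by `U` : it embeds into a direct product of copies of `U`. -/
def Cogenerated (A : ModuleCat.{0} R) : Prop :=
  ∃ (ι : Type) (f : ↥A →ₗ[R] (ι → U)), Function.Injective f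

/-- A minimal injective resolution `0 → M → E 0 → E 1 → ⋯` of `M` : an injective
resolution in which the kernel of each differential is an essential submodule. -/
structure MinInjRes (M : Type) [AddCommGroup M] [Module R M] where
  E : ℕ → ModuleCat.{0} R
  injective : ∀ n, Module.Injective R ↥(E n)
  ι : M →ₗ[R] ↥(E 0)
  d : ∀ n, ↥(E n) →ₗ[R] ↥(E (n + 1))
  ι_inj : Function.Injective ι
  exact_zero : LinearMap.ker (d 0) = LinearMap.range ι
  exact_succ : ∀ n, LinearMap.ker (d (n + 1)) = LinearMap.range (d n)
  essential : ∀ n (B : Submodule R ↥(E n)), B ⊓ LinearMap.ker (d n) = ⊥ → B = ⊥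

end Resol

section Bimodule

variable (Λ Γ : Type) [Ring Λ] [Ring Γ]
variable (U : Type) [AddCommGroup U] [Module Λ U] [Module Γᵐᵒᵖ U]
  [SMulCommClass Λ Γᵐᵒᵖ U] [SMulCommClass Γᵐᵒᵖ Λ U]

/-- Left multiplication `u ↦ a • u` as a `Γᵒᵖ`-linear endomorphism of `U`. -/
def lmul (a : Λ) : U →ₗ[Γᵐᵒᵖ] U where
  toFun u := a • u
  map_add' := smul_add a
  map_smul' γ u := smul_comm a γ u

/-- Right multiplication `u ↦ u γ` as a `Λ`-linear endomorphism of `U`. -/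
def rmul (γ : Γᵐᵒᵖ) : U →ₗ[Λ] U where
  toFun u := γ • u
  map_add' := smul_add γ
  map_smul' a u := smul_comm γ a u

/-- `U` is a faithfully balanced `(Λ,Γ)`-bimodule: the natural maps
`Λ → End(U_Γ)` and `Γ → End(_ΛU)^op` are isomorphisms. -/
def FaithfullyBalanced : Prop :=
  Function.Bijective (lmul Λ Γ U) ∧ Function.Bijective (rmul Λ Γ U)

/-- `U` is selforthogonal: `Ext^i_Λ(U,U) = 0 = Ext^i_Γ(U,U)` for all `i ≥ 1`. -/
def SelfOrthogonal : Prop :=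
  (∀ i, 1 ≤ i → extVanish Λ Γᵐᵒᵖ U (ModuleCat.of Λ U) i) ∧
  (∀ i, 1 ≤ i → extVanish Γᵐᵒᵖ Λ U (ModuleCat.of Γᵐᵒᵖ U) i)

/-- `_ΛU` is `k`-Gorenstein : `s.grade_U Ext^i_Γ(N,U) ≥ i` for every
`N ∈ mod Γᵒᵖ` and all `1 ≤ i ≤ k`. -/
def LeftGorenstein (k : ℕ) : Prop :=
  ∀ N : ModuleCat.{0} Γᵐᵒᵖ, Module.Finite Γᵐᵒᵖ ↥N →
    ∀ i, 1 ≤ i → i ≤ k →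
      sgradeGE Λ Γᵐᵒᵖ U (ModuleCat.of Λ (ExtU Γᵐᵒᵖ Λ U N i)) i

/-- `U_Γ` is `k`-Gorenstein : `s.grade_U Ext^i_Λ(M,U) ≥ i` for every
`M ∈ mod Λ` and all `1 ≤ i ≤ k`. -/
def RightGorenstein (k : ℕ) : Prop :=
  ∀ M : ModuleCat.{0} Λ, Module.Finite Λ ↥M →
    ∀ i, 1 ≤ i → i ≤ k →
      sgradeGE Γᵐᵒᵖ Λ U (ModuleCat.of Γᵐᵒᵖ (ExtU Λ Γᵐᵒᵖ U M i)) i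

end Bimodule

section Helpers
open CategoryTheory CategoryTheory.Abelian

section ExtGeneral
variable {R : Type} [Ring R]

/-- Short exact sequences of modules, unbundled. -/
structure SES {A B C : Type} [AddCommGroup A] [Module R A] [AddCommGroup B] [Module R B]
    [AddCommGroup C] [Module R C] (f : A →ₗ[R] B) (g : B →ₗ[R] C) : Prop where
  inj : Function.Injective f
  surj : Function.Surjective g
  exact : Function.Exact f g

variable {A B C : Type} [AddCommGroup A] [Module R A] [AddCommGroup B] [Module R B]
    [AddCommGroup C] [Module R C] {f : A →ₗ[R] B} {g : B →ₗ[R] C}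

lemma SES.comp_zero (h : SES f g) : g.comp f = 0 := h.exact.linearMap_comp_eq_zero

/-- The associated short complex. -/
abbrev SES.sc (h : SES f g) : ShortComplex (ModuleCat.{0} R) :=
  ShortComplex.mk (ModuleCat.ofHom f) (ModuleCat.ofHom g)
    (by rw [← ModuleCat.ofHom_comp, h.comp_zero]; rfl)

lemma SES.shortExact (h : SES f g) : h.sc.ShortExact :=
  ModuleCat.shortComplex_shortExact h.sc h.exact h.inj h.surj

variable (U : Type) [AddCommGroup U] [Module R U]

/-- Vanishing of the Mathlib `Ext` group. -/
def V (R : Type) [Ring R] (U : Type) [AddCommGroup U] [Module R U] (M : Type) [AddCommGroup M]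
    [Module R M] (n : ℕ) : Prop :=
  ∀ x : Ext (ModuleCat.of R M) (ModuleCat.of R U) n, x = 0

lemma V_zero_iff : V R U A 0 ↔ ∀ φ : A →ₗ[R] U, φ = 0 := by
  constructor
  · intro h φ
    have := h (Ext.mk₀ (ModuleCat.ofHom φ))
    rw [Ext.mk₀_eq_zero_iff] at this
    have := congrArg ModuleCat.Hom.hom this
    simpa using this
  · intro h x
    obtain ⟨φ, rfl⟩ := (Ext.mk₀_bijective _ _).2 x
    rw [Ext.mk₀_eq_zero_iff]
    ext1
    exact h φ.hom

lemma V_proj [Module.Projective R A] (n : ℕ) : V R U A (n + 1) := by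
  intro x
  have : Projective (ModuleCat.of R A) := (ModuleCat.of R A).projective_of_categoryTheory_projective
  exact Ext.eq_zero_of_projective x

lemma V_equiv {M N : Type} [AddCommGroup M] [Module R M] [AddCommGroup N] [Module R N]
    (e : M ≃ₗ[R] N) {n : ℕ} (h : V R U M n) : V R U N n := by
  intro x
  have h1 := h ((Ext.mk₀ e.toModuleIso.hom).comp x (zero_add n))
  have : x = (Ext.mk₀ e.toModuleIso.inv).comp
    ((Ext.mk₀ e.toModuleIso.hom).comp x (zero_add n)) (zero_add n) := by
    rw [Ext.mk₀_comp_mk₀_assoc, Iso.inv_hom_id, Ext.mk₀_id_comp]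
  rw [this, h1, Ext.comp_zero]

variable {U}

lemma SES.V_quot (h : SES f g) {n : ℕ} (hA : V R U A n) (hB : V R U B (n + 1)) :
    V R U C (n + 1) := by
  intro x
  obtain ⟨y, hy⟩ := Ext.contravariant_sequence_exact₃ h.shortExact (ModuleCat.of R U) x (hB _)
    (n₀ := n) (by omega)
  rw [← hy, hA y, Ext.comp_zero]

lemma SES.V_sub (h : SES f g) {n : ℕ} (hB : V R U B n) (hC : V R U C (n + 1)) :
    V R U A n := by
  intro x
  obtain ⟨y, hy⟩ := Ext.contravariant_sequence_exact₁ h.shortExact (ModuleCat.of R U) x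
    (n₁ := n + 1) (by omega) (hC _)
  rw [← hy, hB y, Ext.comp_zero]

lemma SES.V_sub_zero (h : SES f g) (hB : ∀ φ : B →ₗ[R] U, φ.comp f = 0)
    (hC : V R U C 1) : V R U A 0 := by
  intro x
  obtain ⟨y, hy⟩ := Ext.contravariant_sequence_exact₁ h.shortExact (ModuleCat.of R U) x
    (n₁ := 1) (by omega) (hC _)
  obtain ⟨φ, rfl⟩ := (Ext.mk₀_bijective _ _).2 y
  rw [← hy, Ext.mk₀_comp_mk₀, Ext.mk₀_eq_zero_iff]
  ext1
  exact hB φ.hom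

/-- `Ext¹(C,U) = 0` iff homs extend. -/
lemma SES.V_one_iff (h : SES f g) [Module.Projective R B] :
    V R U C 1 ↔ ∀ α : A →ₗ[R] U, ∃ β : B →ₗ[R] U, β.comp f = α := by
  constructor
  · intro hC α
    obtain ⟨y, hy⟩ := Ext.contravariant_sequence_exact₁ h.shortExact (ModuleCat.of R U)
      (Ext.mk₀ (ModuleCat.ofHom α)) (n₁ := 1) (by omega) (hC _)
    obtain ⟨φ, rfl⟩ := (Ext.mk₀_bijective _ _).2 y
    rw [Ext.mk₀_comp_mk₀] at hy
    have := (Ext.mk₀_bijective _ _).1 hy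
    exact ⟨φ.hom, congrArg ModuleCat.Hom.hom this⟩
  · intro H x
    obtain ⟨y, hy⟩ := Ext.contravariant_sequence_exact₃ h.shortExact (ModuleCat.of R U) x
      (V_proj (R := R) (A := B) U 0 _) (n₀ := 0) (by omega)
    obtain ⟨α, rfl⟩ := (Ext.mk₀_bijective _ _).2 y
    obtain ⟨β, hβ⟩ := H α.hom
    have : α = h.sc.f ≫ ModuleCat.ofHom β := by
      ext1
      exact hβ.symm
    rw [← hy, this, ← Ext.mk₀_comp_mk₀]
    exact h.shortExact.extClass_comp_assoc _

lemma SES.V_shift (h : SES f g) [Module.Projective R B] (n : ℕ) :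
    V R U C (n + 2) ↔ V R U A (n + 1) :=
  ⟨fun hC => h.V_sub (V_proj U n) hC, fun hA => h.V_quot hA (V_proj U (n + 1))⟩

end ExtGeneral

section Compare
variable (R : Type) [Ring R] (S : Type) [Ring S]
variable (U : Type) [AddCommGroup U] [Module R U] [Module S U] [SMulCommClass R S U]

/-- Coker of the dual of a map. -/
abbrev Tr {A B : Type} [AddCommGroup A] [Module R A] [AddCommGroup B] [Module R B]
    (f : A →ₗ[R] B) : Type := (A →ₗ[R] U) ⧸ LinearMap.range (precompS R S U f)

lemma subsingleton_Tr_iff {A B : Type} [AddCommGroup A] [Module R A] [AddCommGroup B]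
    [Module R B] (f : A →ₗ[R] B) :
    Subsingleton (Tr R S U f) ↔ ∀ α : A →ₗ[R] U, ∃ β : B →ₗ[R] U, β.comp f = α := by
  rw [Submodule.Quotient.subsingleton_iff, LinearMap.range_eq_top]
  rfl

lemma ses_ker {P N : Type} [AddCommGroup P] [Module R P] [AddCommGroup N] [Module R N]
    (p : P →ₗ[R] N) (hp : Function.Surjective p) : SES (LinearMap.ker p).subtype p where
  inj := Subtype.val_injective
  surj := hp
  exact := by
    rw [LinearMap.exact_iff, Submodule.range_subtype]

lemma cover_surj (N : Type) [AddCommGroup N] [Module R N] : Function.Surjective (cover R N) :=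
  fun x => ⟨Finsupp.single x 1, by simp [cover]⟩

lemma V_syz (M : ModuleCat.{0} R) (n j : ℕ) :
    V R U M (n + (j + 1)) ↔ V R U (syz R M n) (j + 1) := by
  induction n generalizing j with
  | zero => rw [zero_add]; rfl
  | succ n ih =>
    rw [show n + 1 + (j + 1) = n + ((j + 1) + 1) by omega, ih]
    exact (ses_ker R (cover R (syz R M n)) (cover_surj R _)).V_shift j

lemma ext1_iff (N : Type) [AddCommGroup N] [Module R N] :
    Subsingleton (Ext1 R S U N) ↔ V R U N 1 := by
  have h := ses_ker R (cover R N) (cover_surj R N)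
  have h1 := h.V_one_iff (U := U)
  rw [h1]
  change Subsingleton (_ ⧸ ext1Sub R S U N) ↔ _
  rw [Submodule.Quotient.subsingleton_iff, ext1Sub, LinearMap.range_eq_top]
  exact Iff.rfl

lemma extVanish_iff (M : ModuleCat.{0} R) (n : ℕ) : extVanish R S U M n ↔ V R U M n := by
  cases n with
  | zero =>
    rw [V_zero_iff]
    exact ⟨fun h φ => h.elim φ 0, fun h => ⟨fun a b => (h a).trans (h b).symm⟩⟩
  | succ n =>
    rw [V_syz R U M n 0, zero_add]
    exact ext1_iff R S U (syz R M n)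

end Compare

section Duality
variable (R : Type) [Ring R] (S : Type) [Ring S]
variable (U : Type) [AddCommGroup U] [Module R U] [Module S U] [SMulCommClass R S U]

/-- One half of the duality properties of the bimodule `U`. -/
class Half : Prop where
  add : ∀ (P : Type) [AddCommGroup P] [Module R P] [Module.Finite R P] [Module.Projective R P],
    ∃ (n : ℕ) (p : Fin n → (P →ₗ[R] U)) (q : Fin n → (U →ₗ[R] P)),
      ∀ x, ∑ i, q i (p i x) = x
  endo : ∀ φ : U →ₗ[R] U, ∃ s : S, ∀ u, φ u = s • u
  free : Nonempty (S ≃ₗ[S] (U →ₗ[R] U))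

variable [Half R S U]
variable (P : Type) [AddCommGroup P] [Module R P] [Module.Finite R P] [Module.Projective R P]

lemma dual_retract : ∃ (n : ℕ) (i : (P →ₗ[R] U) →ₗ[S] (Fin n → S))
    (r : (Fin n → S) →ₗ[S] (P →ₗ[R] U)), r.comp i = LinearMap.id := by
  obtain ⟨n, p, q, hpq⟩ := Half.add (R := R) (S := S) (U := U) P
  obtain ⟨e⟩ := Half.free (R := R) (S := S) (U := U)
  refine ⟨n, LinearMap.pi fun j => e.symm.toLinearMap.comp (precompS R S U (q j)),
    ∑ j, (precompS R S U (p j)).comp (e.toLinearMap.comp (LinearMap.proj j)), ?_⟩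
  ext α x
  simp only [LinearMap.comp_apply, LinearMap.sum_apply, LinearMap.id_apply]
  simp only [LinearMap.proj_apply, LinearMap.pi_apply, LinearMap.comp_apply,
    LinearEquiv.coe_coe, LinearEquiv.apply_symm_apply]
  conv_rhs => rw [← hpq x, map_sum]
  rfl

instance dual_proj : Module.Projective S (P →ₗ[R] U) := by
  obtain ⟨n, i, r, h⟩ := dual_retract R S U P
  exact Module.Projective.of_split i r h

instance dual_fin : Module.Finite S (P →ₗ[R] U) := by
  obtain ⟨n, i, r, h⟩ := dual_retract R S U P
  exact Module.Finite.of_surjective r (fun x => ⟨i x, LinearMap.congr_fun h x⟩)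

lemma ev_surj (φ : (P →ₗ[R] U) →ₗ[S] U) : ∃ x : P, ∀ α, φ α = α x := by
  obtain ⟨n, p, q, hpq⟩ := Half.add (R := R) (S := S) (U := U) P
  refine ⟨∑ i, q i (φ (p i)), fun α => ?_⟩
  choose s hs using fun i => Half.endo (R := R) (S := S) (α.comp (q i))
  have : α = ∑ i, s i • p i := by
    ext x
    conv_lhs => rw [← hpq x, map_sum]
    simp only [LinearMap.sum_apply, LinearMap.smul_apply]
    exact Finset.sum_congr rfl fun i _ => hs i _
  conv_lhs => rw [this]
  rw [map_sum, map_sum]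
  refine Finset.sum_congr rfl fun i _ => ?_
  rw [map_smul]
  exact (hs i _).symm

end Duality

lemma sep (R : Type) [Ring R] (S : Type) [Ring S]
    (U : Type) [AddCommGroup U] [Module R U] [Module S U] [SMulCommClass R S U] [Half R S U]
    (P : Type) [AddCommGroup P] [Module R P] [Module.Finite R P] [Module.Projective R P]
    {x : P} (hx : ∀ α : P →ₗ[R] U, α x = 0) : x = 0 := by
  obtain ⟨n, p, q, hpq⟩ := Half.add (R := R) (S := S) (U := U) P
  rw [← hpq x]
  simp [hx]

section Stable
variable {R : Type} [Ring R]

/-- Endomorphism factoring through a projective. -/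
def FactProj {N : Type} [AddCommGroup N] [Module R N] (φ : N →ₗ[R] N) : Prop :=
  ∃ Q : ModuleCat.{0} R, Module.Projective R Q ∧ ∃ (s : N →ₗ[R] Q) (t : Q →ₗ[R] N), φ = t.comp s

/-- Stable equivalence of modules. -/
def StabEq (R : Type) [Ring R] (N N' : Type) [AddCommGroup N] [Module R N] [AddCommGroup N']
    [Module R N'] : Prop :=
  ∃ (a : N →ₗ[R] N') (b : N' →ₗ[R] N), FactProj (LinearMap.id - b.comp a) ∧
    FactProj (LinearMap.id - a.comp b)

lemma StabEq.refl (N : Type) [AddCommGroup N] [Module R N] : StabEq R N N :=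
  ⟨LinearMap.id, LinearMap.id, ⟨ModuleCat.of R PUnit, inferInstanceAs (Module.Projective R PUnit), 0, 0, by simp⟩,
    ⟨ModuleCat.of R PUnit, inferInstanceAs (Module.Projective R PUnit), 0, 0, by simp⟩⟩

variable {K P N : Type} [AddCommGroup K] [Module R K] [AddCommGroup P] [Module R P]
  [AddCommGroup N] [Module R N] {ι : K →ₗ[R] P} {π : P →ₗ[R] N}
variable {K' P' N' : Type} [AddCommGroup K'] [Module R K'] [AddCommGroup P'] [Module R P']
  [AddCommGroup N'] [Module R N'] {ι' : K' →ₗ[R] P'} {π' : P' →ₗ[R] N'}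

lemma SES.factor (h : SES ι π) {X : Type} [AddCommGroup X] [Module R X] (u : X →ₗ[R] P)
    (hu : π.comp u = 0) : ∃ w : X →ₗ[R] K, ι.comp w = u := by
  refine ⟨(LinearEquiv.ofInjective ι h.inj).symm.toLinearMap.comp
    (u.codRestrict _ fun x => (h.exact (u x)).1 (LinearMap.congr_fun hu x)), ?_⟩
  ext x
  simp only [LinearMap.comp_apply, LinearEquiv.coe_coe]
  rw [← LinearEquiv.ofInjective_apply (h := h.inj), LinearEquiv.apply_symm_apply]
  rfl

lemma SES.half_lift (h : SES ι π) {φ : N →ₗ[R] N} (hφ : FactProj φ) (φ₀ : P →ₗ[R] P)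
    (φ₁ : K →ₗ[R] K) (h₀ : π.comp φ₀ = φ.comp π) (h₁ : ι.comp φ₁ = φ₀.comp ι) :
    ∃ w : P →ₗ[R] K, φ₁ = w.comp ι := by
  obtain ⟨Q, hQ, s, t, rfl⟩ := hφ
  obtain ⟨t', ht'⟩ := Module.projective_lifting_property π t h.surj
  obtain ⟨w, hw⟩ := h.factor (φ₀ - t'.comp (s.comp π)) (by
    rw [LinearMap.comp_sub, ← LinearMap.comp_assoc, ht', h₀]
    simp [LinearMap.comp_assoc])
  refine ⟨w, ?_⟩
  ext x
  apply h.inj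
  have e1 := LinearMap.congr_fun hw (ι x)
  have e2 := LinearMap.congr_fun h₁ x
  have e3 := LinearMap.congr_fun h.comp_zero x
  simp only [LinearMap.comp_apply, LinearMap.sub_apply, LinearMap.zero_apply] at *
  rw [e1, e2, e3]
  simp

lemma SES.lift_map (h : SES ι π) (h' : SES ι' π') [Module.Projective R P] (a : N →ₗ[R] N') :
    ∃ (a₀ : P →ₗ[R] P') (a₁ : K →ₗ[R] K'), π'.comp a₀ = a.comp π ∧ ι'.comp a₁ = a₀.comp ι := by
  obtain ⟨a₀, ha₀⟩ := Module.projective_lifting_property π' (a.comp π) h'.surj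
  obtain ⟨a₁, ha₁⟩ := h'.factor (a₀.comp ι) (by
    rw [← LinearMap.comp_assoc, ha₀, LinearMap.comp_assoc, h.comp_zero, LinearMap.comp_zero])
  exact ⟨a₀, a₁, ha₀, ha₁⟩

lemma StabEq.lift (hs : StabEq R N N') (h : SES ι π) (h' : SES ι' π') [Module.Projective R P]
    [Module.Projective R P'] :
    ∃ (a₀ : P →ₗ[R] P') (a₁ : K →ₗ[R] K') (b₀ : P' →ₗ[R] P) (b₁ : K' →ₗ[R] K)
      (w : P →ₗ[R] K) (w' : P' →ₗ[R] K'),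
      ι'.comp a₁ = a₀.comp ι ∧ ι.comp b₁ = b₀.comp ι' ∧
      LinearMap.id - b₁.comp a₁ = w.comp ι ∧ LinearMap.id - a₁.comp b₁ = w'.comp ι' := by
  obtain ⟨a, b, h1, h2⟩ := hs
  obtain ⟨a₀, a₁, p1, p2⟩ := h.lift_map h' a
  obtain ⟨b₀, b₁, q1, q2⟩ := h'.lift_map h b
  obtain ⟨w, hw⟩ := h.half_lift h1 (LinearMap.id - b₀.comp a₀) (LinearMap.id - b₁.comp a₁) (by
      rw [LinearMap.comp_sub, LinearMap.sub_comp, ← LinearMap.comp_assoc, q1, LinearMap.comp_assoc,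
        p1]; rfl) (by
      rw [LinearMap.comp_sub, LinearMap.sub_comp, ← LinearMap.comp_assoc, q2, LinearMap.comp_assoc,
        p2]; rfl)
  obtain ⟨w', hw'⟩ := h'.half_lift h2 (LinearMap.id - a₀.comp b₀) (LinearMap.id - a₁.comp b₁) (by
      rw [LinearMap.comp_sub, LinearMap.sub_comp, ← LinearMap.comp_assoc, p1, LinearMap.comp_assoc,
        q1]; rfl) (by
      rw [LinearMap.comp_sub, LinearMap.sub_comp, ← LinearMap.comp_assoc, p2, LinearMap.comp_assoc,
        q2]; rfl)
  exact ⟨a₀, a₁, b₀, b₁, w, w', p2, q2, hw, hw'⟩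

lemma StabEq.syz (hs : StabEq R N N') (h : SES ι π) (h' : SES ι' π') [Module.Projective R P]
    [Module.Projective R P'] : StabEq R K K' := by
  obtain ⟨a₀, a₁, b₀, b₁, w, w', -, -, h3, h4⟩ := hs.lift h h'
  exact ⟨a₁, b₁, ⟨ModuleCat.of R P, inferInstanceAs (Module.Projective R P), ι, w, h3⟩,
    ⟨ModuleCat.of R P', inferInstanceAs (Module.Projective R P'), ι', w', h4⟩⟩

variable (S : Type) [Ring S]
variable (U : Type) [AddCommGroup U] [Module R U] [Module S U] [SMulCommClass R S U]

/-- Map induced on cokernels of duals. -/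
def trMap (a₀ : P →ₗ[R] P') (a₁ : K →ₗ[R] K') (h : ι'.comp a₁ = a₀.comp ι) :
    Tr R S U ι' →ₗ[S] Tr R S U ι :=
  Submodule.mapQ _ _ (precompS R S U a₁) (by
    rintro _ ⟨β, rfl⟩
    refine ⟨β.comp a₀, ?_⟩
    change (β.comp a₀).comp ι = (β.comp ι').comp a₁
    rw [LinearMap.comp_assoc, LinearMap.comp_assoc, h])

lemma StabEq.tr (hs : StabEq R N N') (h : SES ι π) (h' : SES ι' π') [Module.Projective R P]
    [Module.Projective R P'] : Nonempty (Tr R S U ι ≃ₗ[S] Tr R S U ι') := by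
  obtain ⟨a₀, a₁, b₀, b₁, w, w', h1, h2, h3, h4⟩ := hs.lift h h'
  refine ⟨LinearEquiv.ofLinearMap (trMap S U b₀ b₁ h2) (trMap S U a₀ a₁ h1) ?_ ?_⟩
  · ext α : 2
    refine (Submodule.Quotient.eq' _).2 ⟨α.comp w', ?_⟩
    change (α.comp w').comp ι' = - (α.comp a₁).comp b₁ + α
    rw [LinearMap.comp_assoc, ← h4]
    ext x
    simp
    abel
  · ext α : 2
    refine (Submodule.Quotient.eq' _).2 ⟨α.comp w, ?_⟩
    change (α.comp w).comp ι = - (α.comp b₁).comp a₁ + α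
    rw [LinearMap.comp_assoc, ← h3]
    ext x
    simp
    abel

end Stable

lemma ext1_equiv {R : Type} [Ring R] (S : Type) [Ring S]
    (U : Type) [AddCommGroup U] [Module R U] [Module S U] [SMulCommClass R S U]
    {N N' K' P' : Type} [AddCommGroup N] [Module R N] [AddCommGroup K'] [Module R K']
    [AddCommGroup P'] [Module R P'] [AddCommGroup N'] [Module R N'] {ι' : K' →ₗ[R] P'}
    {π' : P' →ₗ[R] N'} (hs : StabEq R N N') (h' : SES ι' π') [Module.Projective R P'] :
    Nonempty (Ext1 R S U N ≃ₗ[S] Tr R S U ι') := by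
  have h := ses_ker R (cover R N) (cover_surj R N)
  have h1 := hs.tr S U h h'
  exact h1

section TrFacts
variable {R : Type} [Ring R]

/-- Two-term presentation `P₁ → P₀ → A → 0`. -/
structure Pres {A P₁ P₀ : Type} [AddCommGroup A] [Module R A] [AddCommGroup P₁] [Module R P₁]
    [AddCommGroup P₀] [Module R P₀] (f : P₁ →ₗ[R] P₀) (g : P₀ →ₗ[R] A) : Prop where
  surj : Function.Surjective g
  exact : Function.Exact f g

variable {A Q C P₁ P₀ : Type} [AddCommGroup A] [Module R A] [AddCommGroup Q] [Module R Q]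
    [AddCommGroup C] [Module R C] [AddCommGroup P₁] [Module R P₁]
    [AddCommGroup P₀] [Module R P₀] {ι : A →ₗ[R] Q} {π : Q →ₗ[R] C}
    {f : P₁ →ₗ[R] P₀} {g : P₀ →ₗ[R] A}

lemma Pres.comp_zero (h : Pres f g) : g.comp f = 0 := h.exact.linearMap_comp_eq_zero

lemma Pres.splice (h : SES ι π) {g : P₀ →ₗ[R] A} (hg : Function.Surjective g) :
    Pres (ι.comp g) π where
  surj := h.surj
  exact := by
    intro y
    rw [h.exact y]
    constructor
    · rintro ⟨a, rfl⟩
      obtain ⟨x, rfl⟩ := hg a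
      exact ⟨x, rfl⟩
    · rintro ⟨x, rfl⟩
      exact ⟨g x, rfl⟩

/-- Maps killing `f` factor through `g`. -/
lemma Pres.factor (h : Pres f g) {X : Type} [AddCommGroup X] [Module R X] (β : P₀ →ₗ[R] X)
    (hβ : β.comp f = 0) : ∃ α : A →ₗ[R] X, α.comp g = β := by
  have hk : LinearMap.ker g ≤ LinearMap.ker β := by
    intro x hx
    obtain ⟨y, rfl⟩ := (h.exact x).1 hx
    exact LinearMap.congr_fun hβ y
  refine ⟨((LinearMap.ker g).liftQ β hk).comp
    (g.quotKerEquivOfSurjective h.surj).symm.toLinearMap, ?_⟩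
  ext x
  have : (g.quotKerEquivOfSurjective h.surj).symm (g x) = (LinearMap.ker g).mkQ x := by
    rw [LinearEquiv.symm_apply_eq]
    rfl
  simp only [LinearMap.comp_apply, LinearEquiv.coe_coe]
  rw [this]
  simp

variable (S : Type) [Ring S]
variable (U : Type) [AddCommGroup U] [Module R U] [Module S U] [SMulCommClass R S U]

lemma ses_I (f : P₁ →ₗ[R] P₀) :
    SES (LinearMap.range (precompS R S U f)).subtype
      (LinearMap.range (precompS R S U f)).mkQ where
  inj := Subtype.val_injective
  surj := Submodule.mkQ_surjective _
  exact := by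
    rw [LinearMap.exact_iff, Submodule.range_subtype, Submodule.ker_mkQ]

/-- The map `[α] ↦ [α ∘ g]`. -/
def trJ (ι : A →ₗ[R] Q) (g : P₀ →ₗ[R] A) : Tr R S U ι →ₗ[S] Tr R S U (ι.comp g) :=
  Submodule.mapQ _ _ (precompS R S U g) (by
    rintro _ ⟨β, rfl⟩
    exact ⟨β, rfl⟩)

variable {S U} in
lemma trJ_mk (ι : A →ₗ[R] Q) (g : P₀ →ₗ[R] A) (α : A →ₗ[R] U) :
    trJ S U ι g (Submodule.Quotient.mk α) = Submodule.Quotient.mk (α.comp g) := rfl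

/-- The map `[β] ↦ β ∘ f`. -/
def trM (h : Pres f g) (ι : A →ₗ[R] Q) :
    Tr R S U (ι.comp g) →ₗ[S] LinearMap.range (precompS R S U f) :=
  Submodule.liftQ _ (precompS R S U f).rangeRestrict (by
    rintro _ ⟨β, rfl⟩
    refine Subtype.ext ?_
    change (β.comp (ι.comp g)).comp f = 0
    rw [LinearMap.comp_assoc, LinearMap.comp_assoc, h.comp_zero]
    simp)

lemma ses_J (h : Pres f g) (ι : A →ₗ[R] Q) : SES (trJ S U ι g) (trM S U h ι) where
  inj := by
    rw [← LinearMap.ker_eq_bot, LinearMap.ker_eq_bot']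
    intro m hm
    induction m using Submodule.Quotient.induction_on with | _ α =>
    rw [trJ_mk, Submodule.Quotient.mk_eq_zero] at hm
    obtain ⟨β, hβ⟩ := hm
    rw [Submodule.Quotient.mk_eq_zero]
    refine ⟨β, ?_⟩
    ext a
    obtain ⟨x, rfl⟩ := h.surj a
    exact LinearMap.congr_fun hβ x
  surj := by
    rintro ⟨_, β, rfl⟩
    exact ⟨Submodule.Quotient.mk β, rfl⟩
  exact := by
    intro y
    induction y using Submodule.Quotient.induction_on with | _ β =>
    constructor
    · intro hy
      have : β.comp f = 0 := congrArg Subtype.val hy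
      obtain ⟨α, rfl⟩ := h.factor β this
      exact ⟨Submodule.Quotient.mk α, rfl⟩
    · rintro ⟨x, hx⟩
      induction x using Submodule.Quotient.induction_on with | _ α =>
      rw [← hx]
      refine Subtype.ext ?_
      change (α.comp g).comp f = 0
      rw [LinearMap.comp_assoc, h.comp_zero, LinearMap.comp_zero]

variable {S U}
variable [Half R S U] [Module.Finite R P₁] [Module.Projective R P₁]
  [Module.Finite R P₀] [Module.Projective R P₀]

lemma tr_quot (h : Pres f g) (ι : A →ₗ[R] Q) {n : ℕ} (h1 : V S U (Tr R S U ι) n)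
    (h2 : V S U (Tr R S U (ι.comp g)) (n + 1)) : V S U (Tr R S U f) (n + 2) :=
  ((ses_I S U f).V_shift n).2 ((ses_J S U h ι).V_quot h1 h2)

lemma tr_sub (h : Pres f g) (ι : A →ₗ[R] Q) {n : ℕ} (h1 : V S U (Tr R S U f) (n + 2))
    (h2 : V S U (Tr R S U (ι.comp g)) n) : V S U (Tr R S U ι) n :=
  (ses_J S U h ι).V_sub h2 (((ses_I S U f).V_shift n).1 h1)

lemma tr_kill [Module.Finite R Q] [Module.Projective R Q]
    (hι : Function.Injective ι) (g : P₀ →ₗ[R] A) (φ : Tr R S U (ι.comp g) →ₗ[S] U) :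
    φ.comp (trJ S U ι g) = 0 := by
  obtain ⟨x, hx⟩ := ev_surj R S U P₀ (φ.comp (Submodule.mkQ _))
  have h0 : ι (g x) = 0 := by
    refine sep R S U Q fun β => ?_
    have h2 : φ (Submodule.Quotient.mk (β.comp (ι.comp g))) = (β.comp (ι.comp g)) x :=
      hx (β.comp (ι.comp g))
    have h1 : (Submodule.Quotient.mk (β.comp (ι.comp g)) : Tr R S U (ι.comp g)) = 0 := by
      rw [Submodule.Quotient.mk_eq_zero]
      exact ⟨β, rfl⟩
    rw [h1, map_zero] at h2
    exact h2.symm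
  have h1 : g x = 0 := hι (by rw [h0, map_zero])
  refine LinearMap.ext fun m => ?_
  induction m using Submodule.Quotient.induction_on with | _ α =>
  change φ (Submodule.Quotient.mk (α.comp g)) = 0
  have h2 : φ (Submodule.Quotient.mk (α.comp g)) = (α.comp g) x := hx (α.comp g)
  rw [h2, LinearMap.comp_apply, h1, map_zero]

lemma tr_sub_zero (h : Pres f g) [Module.Finite R Q] [Module.Projective R Q]
    (hι : Function.Injective ι) (h1 : V S U (Tr R S U f) 2) : V S U (Tr R S U ι) 0 :=
  (ses_J S U h ι).V_sub_zero (fun φ => tr_kill hι g φ) (((ses_I S U f).V_shift 0).1 h1)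

lemma tr_one (h : Pres f g) [Module.Finite R Q] [Module.Projective R Q]
    (hι : Function.Injective ι) : V S U (Tr R S U f) 1 := by
  rw [(ses_I S U f).V_one_iff]
  intro γ
  obtain ⟨x, hx⟩ := ev_surj R S U P₀ (γ.comp (precompS R S U f).rangeRestrict)
  have h0 : ι (g x) = 0 := by
    refine sep R S U Q fun β => ?_
    have h2 := hx (β.comp (ι.comp g))
    rw [LinearMap.comp_apply] at h2
    have h1 : (precompS R S U f).rangeRestrict (β.comp (ι.comp g)) = 0 := by
      refine Subtype.ext ?_
      change (β.comp (ι.comp g)).comp f = 0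
      rw [LinearMap.comp_assoc, LinearMap.comp_assoc, h.comp_zero]
      simp
    rw [h1, map_zero] at h2
    exact h2.symm
  obtain ⟨y, rfl⟩ := (h.exact x).1 (hι (by rw [h0, map_zero]))
  refine ⟨LinearMap.applyₗ' S y, ?_⟩
  ext ⟨_, β, rfl⟩
  exact (hx β).symm

lemma tr_one_conv (h : Pres f g) (h1 : V S U (Tr R S U f) 1) {a : A}
    (ha : ∀ α : A →ₗ[R] U, α a = 0) : a = 0 := by
  rw [(ses_I S U f).V_one_iff] at h1
  obtain ⟨x, rfl⟩ := h.surj a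
  have hk : LinearMap.ker (precompS R S U f) ≤
      LinearMap.ker (LinearMap.applyₗ' S x : (P₀ →ₗ[R] U) →ₗ[S] U) := by
    intro β hβ
    obtain ⟨α, rfl⟩ := h.factor β hβ
    exact ha α
  obtain ⟨φ, hφ⟩ := h1 (((LinearMap.ker (precompS R S U f)).liftQ _ hk).comp
    (precompS R S U f).quotKerEquivRange.symm.toLinearMap)
  obtain ⟨y, hy⟩ := ev_surj R S U P₁ φ
  have : x = f y := by
    rw [← sub_eq_zero]
    refine sep R S U P₀ fun β => ?_
    have e1 := LinearMap.congr_fun hφ ⟨precompS R S U f β, β, rfl⟩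
    have e2 : (precompS R S U f).quotKerEquivRange.symm ⟨precompS R S U f β, β, rfl⟩ =
        Submodule.Quotient.mk β := by
      rw [LinearEquiv.symm_apply_eq]
      rfl
    simp only [LinearMap.comp_apply, LinearEquiv.coe_coe] at e1
    rw [e2] at e1
    have e3 : φ (precompS R S U f β) = β x := e1
    rw [hy] at e3
    rw [map_sub, ← e3]
    exact sub_self _
  rw [this]
  exact LinearMap.congr_fun h.comp_zero y

end TrFacts

section Syzygy
variable {R : Type} [Ring R]

lemma IsSyzygy.equiv {k : ℕ} {A B : Type} [AddCommGroup A] [Module R A] [AddCommGroup B]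
    [Module R B] (e : A ≃ₗ[R] B) (h : IsSyzygy R k (ModuleCat.of R A)) :
    IsSyzygy R k (ModuleCat.of R B) := by
  cases k with
  | zero => trivial
  | succ k =>
    obtain ⟨P, h1, h2, f, hf, h3⟩ := h
    refine ⟨P, h1, h2, f.comp e.symm.toLinearMap, hf.comp e.symm.injective, ?_⟩
    have : LinearMap.range (f.comp e.symm.toLinearMap) = LinearMap.range f :=
      LinearMap.range_comp_of_range_eq_top _ (LinearEquiv.range _)
    rw [this]
    exact h3

lemma IsSyzygy.pred {k : ℕ} {A : Type} [AddCommGroup A] [Module R A]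
    (h : IsSyzygy R (k + 1) (ModuleCat.of R A)) : IsSyzygy R k (ModuleCat.of R A) := by
  induction k generalizing A with
  | zero => trivial
  | succ k ih =>
    obtain ⟨P, h1, h2, f, hf, h3⟩ := h
    exact ⟨P, h1, h2, f, hf, ih h3⟩

variable {A Q C : Type} [AddCommGroup A] [Module R A] [AddCommGroup Q] [Module R Q]
    [AddCommGroup C] [Module R C] {ι : A →ₗ[R] Q} {π : Q →ₗ[R] C}

lemma SES.ker_eq (h : SES ι π) : LinearMap.range ι = LinearMap.ker π :=
  ((LinearMap.exact_iff).1 h.exact).symm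

lemma IsSyzygy.succ (h : SES ι π) [Module.Finite R Q] [Module.Projective R Q] {k : ℕ}
    (hC : IsSyzygy R k (ModuleCat.of R C)) : IsSyzygy R (k + 1) (ModuleCat.of R A) := by
  refine ⟨ModuleCat.of R Q, inferInstanceAs (Module.Finite R Q),
    inferInstanceAs (Module.Projective R Q), ι, h.inj, ?_⟩
  refine IsSyzygy.equiv (A := C) (B := Q ⧸ LinearMap.range ι) ?_ hC
  exact ((Submodule.quotEquivOfEq _ _ h.ker_eq).trans
    (π.quotKerEquivOfSurjective h.surj)).symm

lemma ses_quot (hι : Function.Injective ι) : SES ι (LinearMap.range ι).mkQ where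
  inj := hι
  surj := Submodule.mkQ_surjective _
  exact := by rw [LinearMap.exact_iff, Submodule.ker_mkQ]

lemma IsSyzygy.exists_ses {k : ℕ} (h : IsSyzygy R (k + 1) (ModuleCat.of R A)) :
    ∃ (Q C : ModuleCat.{0} R) (ι : A →ₗ[R] Q) (π : Q →ₗ[R] C), SES ι π ∧
      Module.Finite R Q ∧ Module.Projective R Q ∧ Module.Finite R C ∧ IsSyzygy R k C := by
  obtain ⟨P, h1, h2, f, hf, h3⟩ := h
  exact ⟨P, ModuleCat.of R (P ⧸ LinearMap.range f), f, (LinearMap.range f).mkQ, ses_quot hf,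
    h1, h2, inferInstanceAs (Module.Finite R (P ⧸ LinearMap.range f)), h3⟩

lemma exists_cover (A : Type) [AddCommGroup A] [Module R A] [Module.Finite R A] :
    ∃ (n : ℕ) (g : (Fin n → R) →ₗ[R] A), Function.Surjective g :=
  Module.Finite.exists_fin' R A

lemma syz_of (n : ℕ) (C : ModuleCat.{0} R) (hC : Module.Finite R C) (h : IsSyzygy R n C) :
    ∃ M : ModuleCat.{0} R, Module.Finite R M ∧ StabEq R (syz R M n) C := by
  induction n generalizing C with
  | zero => exact ⟨C, hC, StabEq.refl _⟩
  | succ n ih =>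
    obtain ⟨Q, C', ι, π, h1, h2, h3, h4, h5⟩ := IsSyzygy.exists_ses (A := C) h
    obtain ⟨M, hM, hM'⟩ := ih C' h4 h5
    exact ⟨M, hM, hM'.syz (ses_ker R (cover R (syz R M n)) (cover_surj R _)) h1⟩

variable [IsNoetherianRing R]

lemma exists_pres (A : Type) [AddCommGroup A] [Module R A] [Module.Finite R A] :
    ∃ (m n : ℕ) (f : (Fin m → R) →ₗ[R] (Fin n → R)) (g : (Fin n → R) →ₗ[R] A), Pres f g := by
  obtain ⟨n, g, hg⟩ := exists_cover (R := R) A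
  obtain ⟨m, f, hf⟩ := exists_cover (R := R) (LinearMap.ker g)
  exact ⟨m, n, _, g, Pres.splice (ses_ker R g hg) hf⟩

lemma syz_exists (M : ModuleCat.{0} R) (hM : Module.Finite R M) (n : ℕ) :
    ∃ C : ModuleCat.{0} R, Module.Finite R C ∧ IsSyzygy R n C ∧ StabEq R (syz R M n) C := by
  induction n with
  | zero => exact ⟨M, hM, trivial, StabEq.refl _⟩
  | succ n ih =>
    obtain ⟨C, h1, h2, h3⟩ := ih
    obtain ⟨m, g, hg⟩ := exists_cover (R := R) C
    have hs := ses_ker R g hg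
    refine ⟨ModuleCat.of R (LinearMap.ker g), inferInstanceAs (Module.Finite R (LinearMap.ker g)),
      IsSyzygy.succ hs h2, ?_⟩
    exact h3.syz (ses_ker R (cover R (syz R M n)) (cover_surj R _)) hs

end Syzygy

section Conditions
variable (R : Type) [Ring R] (S : Type) [Ring S]
variable (U : Type) [AddCommGroup U] [Module R U] [Module S U] [SMulCommClass R S U]

/-- Condition (1). -/
def C1 (k : ℕ) : Prop := ∀ M : ModuleCat.{0} R, Module.Finite R M → ∀ i, 1 ≤ i → i ≤ k →
  ∀ j < i, V S U (ExtU R S U M (i + 1)) j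

/-- Condition (2). -/
def C2 (k : ℕ) : Prop := ∀ M : ModuleCat.{0} R, Module.Finite R M → ∀ i, 1 ≤ i → i ≤ k →
  V S U (ExtU R S U M (i + 1)) (i - 1)

/-- Syzygies of order `k` are torsionfree of order `k`. -/
def OT (k : ℕ) : Prop := ∀ (A P₁ P₀ : Type) [AddCommGroup A] [Module R A] [AddCommGroup P₁]
  [Module R P₁] [AddCommGroup P₀] [Module R P₀] [Module.Finite R P₁] [Module.Projective R P₁]
  [Module.Finite R P₀] [Module.Projective R P₀] (f : P₁ →ₗ[R] P₀) (g : P₀ →ₗ[R] A), Pres f g →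
  IsSyzygy R k (ModuleCat.of R A) → ∀ i, 1 ≤ i → i ≤ k → V S U (Tr R S U f) i

variable {R S U}

lemma extU_equiv {M : ModuleCat.{0} R} {n : ℕ} {A Q C : Type} [AddCommGroup A] [Module R A]
    [AddCommGroup Q] [Module R Q]
    [AddCommGroup C] [Module R C] {ι : A →ₗ[R] Q} {π : Q →ₗ[R] C} (hs : StabEq R (syz R M n) C)
    (h : SES ι π) [Module.Projective R Q] : Nonempty (ExtU R S U M (n + 1) ≃ₗ[S] Tr R S U ι) :=
  ext1_equiv S U hs h

variable [Half R S U]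

lemma C1.OT {k : ℕ} (h : C1 R S U k) (n : ℕ) (hn : n ≤ k + 1) : OT R S U n := by
  induction n with
  | zero => exact fun A P₁ P₀ _ _ _ _ _ _ _ _ _ _ f g _ _ i h1 h2 => absurd (h1.trans h2) (by omega)
  | succ n ih =>
    intro A P₁ P₀ _ _ _ _ _ _ _ _ _ _ f g hp hA a ha1 ha2
    obtain ⟨Q, C, ι, π, h1, h2, h3, h4, h5⟩ := IsSyzygy.exists_ses (A := A) hA
    obtain rfl | ⟨b, rfl⟩ : a = 1 ∨ ∃ b, a = b + 2 := by
      rcases a with _ | _ | b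
      · omega
      · simp
      · exact Or.inr ⟨b, rfl⟩
    · exact tr_one hp h1.inj
    · obtain ⟨M, hM, hM'⟩ := syz_of n C h4 h5
      obtain ⟨e⟩ := extU_equiv (S := S) (U := U) hM' h1
      refine tr_quot hp ι (V_equiv U e (h M hM n (by omega) (by omega) b (by omega))) ?_
      exact ih (by omega) C P₀ Q (ι.comp g) π (Pres.splice h1 hp.surj) h5 _ (by omega) (by omega)

lemma C1_of_C2 [IsNoetherianRing R] {k : ℕ} (h : C2 R S U k) : C1 R S U k := by
  intro M hM i hi1 hi2 j hj
  obtain ⟨d, rfl⟩ : ∃ d, i = d + (j + 1) := ⟨i - (j + 1), by omega⟩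
  obtain ⟨C, h1, h2, h3⟩ := syz_exists M hM d
  have key : ∀ t, StabEq R (syz R M (d + t)) (syz R C t) := by
    intro t
    induction t with
    | zero => exact h3
    | succ t ih =>
      exact ih.syz (ses_ker R (cover R (syz R M (d + t))) (cover_surj R _))
        (ses_ker R (cover R (syz R C t)) (cover_surj R _))
  have h4 := ses_ker R (cover R (syz R C (j + 1))) (cover_surj R _)
  obtain ⟨e⟩ := extU_equiv (S := S) (U := U) (key (j + 1)) h4
  obtain ⟨e'⟩ := extU_equiv (S := S) (U := U) (StabEq.refl (syz R C (j + 1))) h4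
  exact V_equiv U (e'.trans e.symm) (h C h1 (j + 1) (by omega) (by omega))

lemma C2_of_OT [IsNoetherianRing R] {k : ℕ} (h : ∀ n ≤ k + 1, OT R S U n) : C2 R S U k := by
  intro M hM i hi1 hi2
  obtain ⟨C, h1, h2, h3⟩ := syz_exists M hM i
  obtain ⟨m, π, hπ⟩ := exists_cover (R := R) C
  have hs := ses_ker R π hπ
  obtain ⟨a, b, f, g, hp⟩ := exists_pres (R := R) (LinearMap.ker π)
  obtain ⟨e⟩ := extU_equiv (S := S) (U := U) h3 hs
  refine V_equiv U e.symm ?_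
  have hA := h (i + 1) (by omega) _ _ _ f g hp (IsSyzygy.succ hs h2) (i + 1) (by omega) (by omega)
  obtain rfl | ⟨b, rfl⟩ : i = 1 ∨ ∃ b, i = b + 2 := by
      rcases i with _ | _ | b
      · omega
      · simp
      · exact Or.inr ⟨b, rfl⟩
  · exact tr_sub_zero hp hs.inj hA
  · refine tr_sub hp _ hA ?_
    exact h (b + 2) (by omega) C _ _ _ _ (Pres.splice hs hp.surj) h2 (b + 1)
      (by omega) (by omega)

end Conditions

section TO
variable {R : Type} [Ring R] {S : Type} [Ring S]
variable {U : Type} [AddCommGroup U] [Module R U] [Module S U] [SMulCommClass R S U]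
  [SMulCommClass S R U] [Half R S U] [Half S R U]

/-- The map `a ↦ (l ↦ σ l a)`. -/
def theta {A L : Type} [AddCommGroup A] [Module R A] [AddCommGroup L] [Module S L]
    (σ : L →ₗ[S] (A →ₗ[R] U)) : A →ₗ[R] (L →ₗ[S] U) where
  toFun a :=
    { toFun := fun l => σ l a
      map_add' := fun l l' => by simp
      map_smul' := fun s l => by simp }
  map_add' a b := by ext l; simp
  map_smul' r a := by ext l; simp

/-- The dual of the presentation obtained from a cover of the dual. -/
lemma tr_theta {A L P₁ P₀ : Type} [AddCommGroup A] [Module R A] [AddCommGroup L] [Module S L]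
    [AddCommGroup P₁] [Module R P₁] [AddCommGroup P₀] [Module R P₀]
    [Module.Finite S L] [Module.Projective S L]
    (σ : L →ₗ[S] (A →ₗ[R] U)) (hσ : Function.Surjective σ)
    {f : P₁ →ₗ[R] P₀} {g : P₀ →ₗ[R] A} (h : Pres f g) :
    Nonempty (Tr R S U ((theta σ).comp g) ≃ₗ[S] LinearMap.range (precompS R S U f)) := by
  refine ⟨(Submodule.quotEquivOfEq _ _ ?_).trans (precompS R S U f).quotKerEquivRange⟩
  ext β
  constructor
  · rintro ⟨ψ, rfl⟩
    change (ψ.comp ((theta σ).comp g)).comp f = 0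
    rw [LinearMap.comp_assoc, LinearMap.comp_assoc, h.comp_zero]
    simp
  · intro hβ
    obtain ⟨α, rfl⟩ := h.factor β hβ
    obtain ⟨l, rfl⟩ := hσ α
    exact ⟨LinearMap.applyₗ' R l, rfl⟩

variable [IsNoetherianRing S]

lemma IsSyzygy_of_tr (k : ℕ) (A P₁ P₀ : Type) [AddCommGroup A] [Module R A] [AddCommGroup P₁]
    [Module R P₁] [AddCommGroup P₀] [Module R P₀] [Module.Finite R P₁] [Module.Projective R P₁]
    [Module.Finite R P₀] [Module.Projective R P₀] (f : P₁ →ₗ[R] P₀) (g : P₀ →ₗ[R] A)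
    (hp : Pres f g) (h : ∀ i, 1 ≤ i → i ≤ k → V S U (Tr R S U f) i) :
    IsSyzygy R k (ModuleCat.of R A) := by
  induction k generalizing A P₁ P₀ with
  | zero => trivial
  | succ k ih =>
    have hfin : Module.Finite S (A →ₗ[R] U) := by
      refine Module.Finite.of_injective (precompS R S U g) ?_
      intro α α' hh
      ext a
      obtain ⟨x, rfl⟩ := hp.surj a
      exact LinearMap.congr_fun hh x
    obtain ⟨n, σ, hσ⟩ := exists_cover (R := S) (A →ₗ[R] U)
    have hinj : Function.Injective (theta σ) := by
      rw [← LinearMap.ker_eq_bot, LinearMap.ker_eq_bot']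
      intro a ha
      refine tr_one_conv hp (h 1 le_rfl (by omega)) fun α => ?_
      obtain ⟨l, rfl⟩ := hσ α
      exact LinearMap.congr_fun ha l
    have hs := ses_quot hinj
    refine IsSyzygy.succ hs (ih _ _ _ ((theta σ).comp g) _ (Pres.splice hs hp.surj) ?_)
    intro i hi1 hi2
    obtain ⟨e⟩ := tr_theta σ hσ hp
    obtain ⟨j, rfl⟩ : ∃ j, i = j + 1 := ⟨i - 1, by omega⟩
    exact V_equiv U e.symm (((ses_I S U f).V_shift j).1 (h (j + 2) (by omega) (by omega)))

end TO

section ExtInto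
variable {S : Type} [Ring S] {R : Type} [Ring R]
variable {U : Type} [AddCommGroup U] [Module R U] [Module S U]
  [SMulCommClass S R U] [Half S R U]

lemma V_to_proj (R : Type) [Ring R] {U : Type} [AddCommGroup U] [Module R U] [Module S U]
    [SMulCommClass S R U] [Half S R U] {Z A : Type} [AddCommGroup Z] [Module S Z] [AddCommGroup A]
    [Module S A] [Module.Finite S A] [Module.Projective S A] {n : ℕ} (h : V S U Z n)
    (x : Ext (ModuleCat.of S Z) (ModuleCat.of S A) n) : x = 0 := by
  obtain ⟨r, p, q, hpq⟩ := Half.add (R := S) (S := R) (U := U) A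
  have e1 : ∑ i, ModuleCat.ofHom (p i) ≫ ModuleCat.ofHom (q i) = 𝟙 (ModuleCat.of S A) := by
    ext a
    simp only [ModuleCat.hom_sum, LinearMap.sum_apply]
    exact hpq a
  rw [← x.comp_mk₀_id, ← e1, Ext.mk₀_sum, Ext.comp_sum]
  refine Finset.sum_eq_zero fun i _ => ?_
  have h2 := h (x.comp (Ext.mk₀ (ModuleCat.ofHom (p i))) (add_zero n))
  rw [← Ext.mk₀_comp_mk₀, ← Ext.comp_assoc_of_third_deg_zero, h2, Ext.zero_comp]

lemma K1 (R : Type) [Ring R] {U : Type} [AddCommGroup U] [Module R U] [Module S U]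
    [SMulCommClass S R U] [Half S R U] (m : ℕ) {Z E B : Type} [AddCommGroup Z] [Module S Z]
    [AddCommGroup E] [Module S E]
    [AddCommGroup B] [Module S B] (hB : IsSyzygy S (m + 1) (ModuleCat.of S B))
    (hZ : ∀ j, 1 ≤ j → j ≤ m → V S U Z j) (u : E →ₗ[S] Z) (hu : ∀ φ : Z →ₗ[S] U, φ.comp u = 0)
    (c : Ext (ModuleCat.of S Z) (ModuleCat.of S B) m) :
    (Ext.mk₀ (ModuleCat.ofHom u)).comp c (zero_add m) = 0 := by
  induction m generalizing B with
  | zero =>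
    obtain ⟨Q, C, ι, π, h1, h2, h3, h4, h5⟩ := hB.exists_ses
    obtain ⟨ψ, rfl⟩ := (Ext.mk₀_bijective _ _).2 c
    rw [Ext.mk₀_comp_mk₀, Ext.mk₀_eq_zero_iff]
    ext x
    apply h1.inj
    refine Eq.trans ?_ (map_zero ι).symm
    change ι (ψ.hom (u x)) = 0
    refine sep S R U Q fun α => ?_
    exact LinearMap.congr_fun (hu (α.comp (ι.comp ψ.hom))) x
  | succ m ih =>
    obtain ⟨Q, C, ι, π, h1, h2, h3, h4, h5⟩ := hB.exists_ses
    obtain ⟨c', hc'⟩ := Ext.covariant_sequence_exact₁ (ModuleCat.of S Z) h1.shortExact c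
      (V_to_proj R (A := Q) (hZ (m + 1) (by omega) le_rfl) _) (n₀ := m) rfl
    have h6 := ih (B := C) h5 (fun j hj hj' => hZ j hj (by omega)) c'
    rw [← hc', ← Ext.comp_assoc (h₁₂ := zero_add m) (h := by omega), h6, Ext.zero_comp]

/-- Existence of a class detecting maps. -/
def InjC (S : Type) [Ring S] (U : Type) [AddCommGroup U] [Module S U] (m : ℕ) (Z B : Type)
    [AddCommGroup Z] [Module S Z] [AddCommGroup B] [Module S B] : Prop :=
  ∃ c : Ext (ModuleCat.of S Z) (ModuleCat.of S B) m, ∀ (E : ModuleCat.{0} S) (n t : ℕ)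
    (hnt : n + m = t),
    (∀ j, n ≤ j → j < t → V S U E j) → ∀ u : Ext E (ModuleCat.of S Z) n,
      u.comp c hnt = 0 → u = 0

lemma InjC.zero (Z : Type) [AddCommGroup Z] [Module S Z] : InjC S U 0 Z Z := by
  refine ⟨Ext.mk₀ (𝟙 _), fun E n t hnt _ u hu => ?_⟩
  obtain rfl : t = n := by omega
  rwa [Ext.comp_mk₀_id] at hu

lemma InjC.succ (R : Type) [Ring R] {U : Type} [AddCommGroup U] [Module R U] [Module S U]
    [SMulCommClass S R U] [Half S R U] {m : ℕ} {Z B A Z' : Type} [AddCommGroup Z] [Module S Z]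
    [AddCommGroup B] [Module S B]
    [AddCommGroup A] [Module S A] [AddCommGroup Z'] [Module S Z'] [Module.Finite S A]
    [Module.Projective S A] {i : Z →ₗ[S] A} {p : A →ₗ[S] Z'} (hs : SES i p)
    (h : InjC S U m Z B) : InjC S U (m + 1) Z' B := by
  obtain ⟨c, hc⟩ := h
  refine ⟨hs.shortExact.extClass.comp c (add_comm 1 m), fun E n t hnt hV u hu => ?_⟩
  have h1 : u.comp hs.shortExact.extClass (rfl : n + 1 = n + 1) = 0 := by
    refine hc E (n + 1) t (by omega) (fun j h1 h2 => hV j (by omega) h2) _ ?_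
    rw [Ext.comp_assoc (h₂₃ := add_comm 1 m) (h := by omega)]
    exact hu
  obtain ⟨x, hx⟩ := Ext.covariant_sequence_exact₃ E hs.shortExact u rfl h1
  rw [← hx, V_to_proj R (A := A) (Z := E) (hV n le_rfl (by omega)) x, Ext.zero_comp]

end ExtInto

section Chain
variable {R : Type} [Ring R] {S : Type} [Ring S]
variable {U : Type} [AddCommGroup U] [Module R U] [Module S U] [SMulCommClass R S U]
  [SMulCommClass S R U] [Half R S U] [Half S R U] [IsNoetherianRing R]

lemma chain (M : ModuleCat.{0} R) {P₁ P₀ : Type} [AddCommGroup P₁]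
    [Module R P₁] [AddCommGroup P₀] [Module R P₀] [Module.Finite R P₁] [Module.Projective R P₁]
    [Module.Finite R P₀] [Module.Projective R P₀] (f : P₁ →ₗ[R] P₀) (g : P₀ →ₗ[R] M)
    (hp : Pres f g) (m : ℕ) (hM : ∀ j, 1 ≤ j → j ≤ m → V R U M j) :
    ∃ (N K F₀ F₁ : ModuleCat.{0} R) (ι : K →ₗ[R] F₀) (π : F₀ →ₗ[R] N) (q : F₁ →ₗ[R] K),
      SES ι π ∧ Function.Surjective q ∧ Module.Finite R F₀ ∧ Module.Projective R F₀ ∧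
      Module.Finite R F₁ ∧ Module.Projective R F₁ ∧ IsSyzygy R m N ∧ StabEq R (syz R M m) N ∧
      InjC S U m (Tr R S U (ι.comp q)) (Tr R S U f) := by
  induction m with
  | zero =>
    have hr : LinearMap.range f = LinearMap.ker g := ((LinearMap.exact_iff).1 hp.exact).symm
    have hm : ∀ x, f x ∈ LinearMap.ker g := fun x => hr ▸ ⟨x, rfl⟩
    refine ⟨M, ModuleCat.of R (LinearMap.ker g), ModuleCat.of R P₀, ModuleCat.of R P₁,
      (LinearMap.ker g).subtype, g, f.codRestrict _ hm, ses_ker R g hp.surj, ?_,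
      inferInstanceAs (Module.Finite R P₀), inferInstanceAs (Module.Projective R P₀),
      inferInstanceAs (Module.Finite R P₁), inferInstanceAs (Module.Projective R P₁), trivial,
      StabEq.refl _, InjC.zero (Tr R S U f)⟩
    rintro ⟨y, hy⟩
    obtain ⟨x, rfl⟩ := (hp.exact y).1 hy
    exact ⟨x, rfl⟩
  | succ m ih =>
    obtain ⟨N, K, F₀, F₁, ι, π, q, h1, h2, h3, h4, h5, h6, h7, h8, h9⟩ :=
      ih fun j hj hj' => hM j hj (by omega)
    have hK : Module.Finite R K := Module.Finite.of_surjective q h2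
    have hs := ses_ker R q h2
    obtain ⟨n, q', hq'⟩ := exists_cover (R := R) (LinearMap.ker q)
    refine ⟨K, ModuleCat.of R (LinearMap.ker q), F₁, ModuleCat.of R (Fin n → R),
      (LinearMap.ker q).subtype, q, q', hs, hq', h5, h6,
      inferInstanceAs (Module.Finite R (Fin n → R)),
      inferInstanceAs (Module.Projective R (Fin n → R)), IsSyzygy.succ h1 h7,
      h8.syz (ses_ker R (cover R (syz R M m)) (cover_surj R _)) h1, ?_⟩
    obtain ⟨e⟩ := extU_equiv (S := S) (U := U) h8 h1
    have hv : Subsingleton (ExtU R S U M (m + 1)) :=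
      (extVanish_iff R S U M (m + 1)).2 (hM (m + 1) (by omega) le_rfl)
    have ht : Subsingleton (Tr R S U ι) := e.symm.toEquiv.subsingleton
    have hp' : Pres ((LinearMap.ker q).subtype.comp q') q := Pres.splice hs hq'
    have sJ := ses_J S U hp' ι
    have sI := ses_I S U ((LinearMap.ker q).subtype.comp q')
    have sN : SES ((LinearMap.range (precompS R S U ((LinearMap.ker q).subtype.comp q'))).subtype.comp
        (trM S U hp' ι))
        (LinearMap.range (precompS R S U ((LinearMap.ker q).subtype.comp q'))).mkQ := by
      refine ⟨sI.inj.comp ?_, sI.surj, (Pres.splice sI sJ.surj).exact⟩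
      rw [← LinearMap.ker_eq_bot, LinearMap.ker_eq_bot']
      intro x hx
      obtain ⟨y, rfl⟩ := (sJ.exact x).1 hx
      rw [Subsingleton.elim y 0, map_zero]
    exact InjC.succ R sN h9

lemma double_dual {B Q₁ Q₀ : Type} [AddCommGroup B] [Module S B] [AddCommGroup Q₁]
    [Module S Q₁] [AddCommGroup Q₀] [Module S Q₀] [Module.Finite S Q₁] [Module.Projective S Q₁]
    [Module.Finite S Q₀] [Module.Projective S Q₀] (f : Q₁ →ₗ[S] Q₀) (g : Q₀ →ₗ[S] B)
    (hp : Pres f g) : Nonempty (B ≃ₗ[S] Tr R S U (precompS S R U f)) := by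
  let ev : Q₀ →ₗ[S] ((Q₀ →ₗ[S] U) →ₗ[R] U) := theta LinearMap.id
  obtain ⟨α, hα⟩ := hp.factor ((LinearMap.range (precompS R S U (precompS S R U f))).mkQ.comp ev) (by
    ext1 y
    refine (Submodule.Quotient.mk_eq_zero _).2 ⟨theta LinearMap.id y, ?_⟩
    rfl)
  refine ⟨LinearEquiv.ofBijective α ⟨?_, ?_⟩⟩
  · rw [← LinearMap.ker_eq_bot, LinearMap.ker_eq_bot']
    intro b hb
    obtain ⟨x, rfl⟩ := hp.surj b
    have h1 : α (g x) = Submodule.Quotient.mk (ev x) := LinearMap.congr_fun hα x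
    rw [h1, Submodule.Quotient.mk_eq_zero] at hb
    obtain ⟨ψ, hψ⟩ := hb
    obtain ⟨y, hy⟩ := ev_surj S R U Q₁ ψ
    have : x = f y := by
      rw [← sub_eq_zero]
      refine sep S R U Q₀ fun β => ?_
      have h2 : ψ (β.comp f) = β x := LinearMap.congr_fun hψ β
      rw [hy] at h2
      rw [map_sub, ← h2]
      exact sub_self _
    rw [this]
    exact LinearMap.congr_fun hp.comp_zero y
  · intro z
    induction z using Submodule.Quotient.induction_on with | _ ψ =>
    obtain ⟨x, hx⟩ := ev_surj S R U Q₀ ψ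
    refine ⟨g x, ?_⟩
    have h1 : α (g x) = Submodule.Quotient.mk (ev x) := LinearMap.congr_fun hα x
    rw [h1]
    congr 1
    ext β
    exact (hx β).symm

theorem OT_op {k : ℕ} (h : C1 R S U k) (n : ℕ) (hn : n ≤ k + 1) : OT S R U n := by
  induction n with
  | zero => exact fun A P₁ P₀ _ _ _ _ _ _ _ _ _ _ f g _ _ i h1 h2 => absurd (h1.trans h2) (by omega)
  | succ m ih =>
    intro B Q₁ Q₀ _ _ _ _ _ _ _ _ _ _ f g hp hB a ha1 ha2
    have hprev := ih (by omega) B Q₁ Q₀ f g hp hB.pred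
    rcases Nat.lt_or_ge m a with hlt | hge
    swap
    · exact hprev a ha1 hge
    obtain rfl : a = m + 1 := by omega
    have hp' : Pres (precompS S R U f) (LinearMap.range (precompS S R U f)).mkQ :=
      ⟨Submodule.mkQ_surjective _, by rw [LinearMap.exact_iff, Submodule.ker_mkQ]⟩
    obtain ⟨eB⟩ := double_dual (R := R) (U := U) f g hp
    obtain ⟨N, K, F₀, F₁, ι, π, q, h1, h2, h3, h4, h5, h6, h7, h8, c, hc⟩ :=
      chain (S := S) (U := U) (ModuleCat.of R (Tr S R U f)) (precompS S R U f)
        (LinearMap.range (precompS S R U f)).mkQ hp' m hprev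
    have hfin : Module.Finite R (ModuleCat.of R (Tr S R U f)) :=
      inferInstanceAs (Module.Finite R (Tr S R U f))
    obtain ⟨e⟩ := extU_equiv (S := S) (U := U) h8 h1
    have hZ := h.OT m (by omega) N F₁ F₀ (ι.comp q) π (Pres.splice h1 h2) h7
    have k1 := K1 R m (IsSyzygy.equiv eB hB) hZ (trJ S U ι q) (tr_kill h1.inj q) c
    have hE : ∀ j, 0 ≤ j → j < m → V S U (Tr R S U ι) j := fun j _ hj =>
      V_equiv U e (h _ hfin m (by omega) (by omega) j hj)
    have k2 := hc (ModuleCat.of S (Tr R S U ι)) 0 m (zero_add m) hE _ k1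
    rw [Ext.mk₀_eq_zero_iff] at k2
    have k3 : trJ S U ι q = 0 := congrArg ModuleCat.Hom.hom k2
    have hss : Pres (P₁ := LinearMap.ker q) (LinearMap.ker q).subtype q :=
      ⟨h2, (ses_ker R q h2).exact⟩
    have hj := (ses_J S U hss ι).inj
    have ht : Subsingleton (Tr R S U ι) :=
      ⟨fun x y => hj (by rw [k3]; rfl)⟩
    exact (extVanish_iff R S U _ (m + 1)).1 e.toEquiv.subsingleton

end Chain

section Final
variable (Λ : Type) [Ring Λ]

instance half_left : Half Λ Λᵐᵒᵖ Λ where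
  add P _ _ _ _ := by
    obtain ⟨n, g, hg⟩ := exists_cover (R := Λ) P
    obtain ⟨s, hs⟩ := Module.projective_lifting_property g LinearMap.id hg
    refine ⟨n, fun i => (LinearMap.proj i).comp s,
      fun i => g.comp (LinearMap.single Λ (fun _ => Λ) i), fun x => ?_⟩
    simp only [LinearMap.comp_apply, LinearMap.proj_apply, LinearMap.single_apply]
    rw [← map_sum, Finset.univ_sum_single]
    exact LinearMap.congr_fun hs x
  endo φ := ⟨MulOpposite.op (φ 1), fun u => by
    rw [op_smul_eq_mul, ← smul_eq_mul, ← map_smul, smul_eq_mul, mul_one]⟩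
  free := ⟨LinearEquiv.ofBijective
    ({ toFun := fun s =>
        { toFun := fun u => s • u
          map_add' := smul_add s
          map_smul' := fun a u => smul_comm s a u }
       map_add' := fun s t => LinearMap.ext fun u => add_smul s t u
       map_smul' := fun s t => LinearMap.ext fun u => mul_smul s t u } :
       Λᵐᵒᵖ →ₗ[Λᵐᵒᵖ] (Λ →ₗ[Λ] Λ)) ⟨fun s t h => by
        have := LinearMap.congr_fun h (1 : Λ)
        change s • (1 : Λ) = t • (1 : Λ) at this
        rw [MulOpposite.smul_eq_mul_unop, MulOpposite.smul_eq_mul_unop, one_mul, one_mul] at this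
        exact MulOpposite.unop_injective this, fun φ => ⟨MulOpposite.op (φ 1), LinearMap.ext fun u => by
        change MulOpposite.op (φ 1) • u = φ u
        rw [op_smul_eq_mul, ← smul_eq_mul, ← map_smul, smul_eq_mul, mul_one]⟩⟩⟩

/-- `Λ` as right module is free of rank one. -/
def opEquiv : Λᵐᵒᵖ ≃ₗ[Λᵐᵒᵖ] Λ where
  toFun := MulOpposite.unop
  invFun := MulOpposite.op
  map_add' _ _ := rfl
  map_smul' _ _ := rfl
  left_inv _ := rfl
  right_inv _ := rfl

lemma endo_right (φ : Λ →ₗ[Λᵐᵒᵖ] Λ) (u : Λ) : φ u = φ 1 • u := by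
  have h : u = MulOpposite.op u • (1 : Λ) := by rw [op_smul_eq_mul, one_mul]
  conv_lhs => rw [h, map_smul, op_smul_eq_mul]
  rfl

instance half_right : Half Λᵐᵒᵖ Λ Λ where
  add P _ _ _ _ := by
    obtain ⟨n, g, hg⟩ := exists_cover (R := Λᵐᵒᵖ) P
    obtain ⟨s, hs⟩ := Module.projective_lifting_property g LinearMap.id hg
    refine ⟨n, fun i => (opEquiv Λ).toLinearMap.comp ((LinearMap.proj i).comp s),
      fun i => (g.comp (LinearMap.single Λᵐᵒᵖ (fun _ => Λᵐᵒᵖ) i)).comp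
        (opEquiv Λ).symm.toLinearMap, fun x => ?_⟩
    simp only [LinearMap.comp_apply, LinearMap.proj_apply, LinearMap.single_apply,
      LinearEquiv.coe_coe, LinearEquiv.symm_apply_apply]
    rw [← map_sum, Finset.univ_sum_single]
    exact LinearMap.congr_fun hs x
  endo φ := ⟨φ 1, fun u => endo_right Λ φ u⟩
  free := ⟨LinearEquiv.ofBijective
    ({ toFun := fun s =>
        { toFun := fun u => s • u
          map_add' := smul_add s
          map_smul' := fun a u => smul_comm s a u }
       map_add' := fun s t => LinearMap.ext fun u => add_smul s t u
       map_smul' := fun s t => LinearMap.ext fun u => mul_smul s t u } :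
       Λ →ₗ[Λ] (Λ →ₗ[Λᵐᵒᵖ] Λ)) ⟨fun s t h => by
        have := LinearMap.congr_fun h (1 : Λ)
        change s • (1 : Λ) = t • (1 : Λ) at this
        simpa using this, fun φ => ⟨φ 1, LinearMap.ext fun u => (endo_right Λ φ u).symm⟩⟩⟩

end Final

section Bridge
variable {R : Type} [Ring R] {S : Type} [Ring S]
variable {U : Type} [AddCommGroup U] [Module R U] [Module S U] [SMulCommClass R S U]
  [SMulCommClass S R U]

lemma C1_iff (k : ℕ) : (∀ M : ModuleCat.{0} R, Module.Finite R ↥M → ∀ i, 1 ≤ i → i ≤ k →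
    gradeGE S R U (ModuleCat.of S (ExtU R S U M (i + 1))) i) ↔ C1 R S U k :=
  ⟨fun h M hM i h1 h2 j hj => (extVanish_iff S R U _ j).1 (h M hM i h1 h2 j hj),
    fun h M hM i h1 h2 j hj => (extVanish_iff S R U _ j).2 (h M hM i h1 h2 j hj)⟩

lemma C2_iff (k : ℕ) : (∀ M : ModuleCat.{0} R, Module.Finite R ↥M → ∀ i, 1 ≤ i → i ≤ k →
    extVanish S R U (ModuleCat.of S (ExtU R S U M (i + 1))) (i - 1)) ↔ C2 R S U k :=
  ⟨fun h M hM i h1 h2 => (extVanish_iff S R U _ _).1 (h M hM i h1 h2),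
    fun h M hM i h1 h2 => (extVanish_iff S R U _ _).2 (h M hM i h1 h2)⟩

lemma C2_of_C1 {k : ℕ} (h : C1 R S U k) : C2 R S U k :=
  fun M hM i h1 h2 => h M hM i h1 h2 (i - 1) (by omega)

lemma C3_iff [Half R S U] [Half S R U] [IsNoetherianRing R] [IsNoetherianRing S] (k : ℕ) :
    (∀ i, 1 ≤ i → i ≤ k → ∀ A : ModuleCat.{0} R, Module.Finite R ↥A →
        (IsSyzygy R i A ↔ Torsionfree R S U i A)) ↔ ∀ i ≤ k, OT R S U i := by
  constructor
  · intro h n hn A P₁ P₀ _ _ _ _ _ _ _ _ _ _ f g hp hA i hi1 hi2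
    have hfin : Module.Finite R A := Module.Finite.of_surjective g hp.surj
    exact (extVanish_iff S R U _ i).1 ((h n (by omega) hn (ModuleCat.of R A) hfin).1 hA
      (ModuleCat.of R P₁) (ModuleCat.of R P₀) inferInstance inferInstance inferInstance
      inferInstance f g hp.surj ((LinearMap.exact_iff).1 hp.exact).symm i hi1 hi2)
  · intro h n hn1 hn A hA
    constructor
    · intro hs P₁ P₀ _ _ _ _ f g hg hfg i hi1 hi2
      exact (extVanish_iff S R U _ i).2 (h n hn A P₁ P₀ f g
        ⟨hg, (LinearMap.exact_iff).2 hfg.symm⟩ hs i hi1 hi2)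
    · intro ht
      obtain ⟨a, b, f, g, hp⟩ := exists_pres (R := R) A
      refine IsSyzygy_of_tr (S := S) (U := U) n A _ _ f g hp fun i hi1 hi2 => ?_
      exact (extVanish_iff S R U _ i).1 (ht (ModuleCat.of R (Fin a → R))
        (ModuleCat.of R (Fin b → R)) (inferInstanceAs (Module.Finite R (Fin a → R)))
        (inferInstanceAs (Module.Projective R (Fin a → R)))
        (inferInstanceAs (Module.Finite R (Fin b → R)))
        (inferInstanceAs (Module.Projective R (Fin b → R))) f g hp.surj
        ((LinearMap.exact_iff).1 hp.exact).symm i hi1 hi2)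

end Bridge

end Helpers

section Statement

variable (Λ : Type) [Ring Λ] [IsNoetherianRing Λ] [IsNoetherianRing Λᵐᵒᵖ]

/-- **Corollary 3.4.** For a left and right noetherian ring `Λ` and a positive integer `k`,
the six conditions (grade of `Ext^{i+1}`, vanishing of `Ext^{i-1}(Ext^{i+1}(-))`, and
`Ω^i = T^i`, on both sides) are equivalent. -/
theorem grade_ext_syzygy_torsionfree_tfae (k : ℕ) (hk : 0 < k) :
    [ (∀ M : ModuleCat.{0} Λ, Module.Finite Λ ↥M → ∀ i, 1 ≤ i → i ≤ k - 1 →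
        gradeGE Λᵐᵒᵖ Λ Λ (ModuleCat.of Λᵐᵒᵖ (ExtU Λ Λᵐᵒᵖ Λ M (i + 1))) i),
      (∀ M : ModuleCat.{0} Λ, Module.Finite Λ ↥M → ∀ i, 1 ≤ i → i ≤ k - 1 →
        extVanish Λᵐᵒᵖ Λ Λ (ModuleCat.of Λᵐᵒᵖ (ExtU Λ Λᵐᵒᵖ Λ M (i + 1))) (i - 1)),
      (∀ i, 1 ≤ i → i ≤ k → ∀ A : ModuleCat.{0} Λ, Module.Finite Λ ↥A →
        (IsSyzygy Λ i A ↔ Torsionfree Λ Λᵐᵒᵖ Λ i A)),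
      (∀ N : ModuleCat.{0} Λᵐᵒᵖ, Module.Finite Λᵐᵒᵖ ↥N → ∀ i, 1 ≤ i → i ≤ k - 1 →
        gradeGE Λ Λᵐᵒᵖ Λ (ModuleCat.of Λ (ExtU Λᵐᵒᵖ Λ Λ N (i + 1))) i),
      (∀ N : ModuleCat.{0} Λᵐᵒᵖ, Module.Finite Λᵐᵒᵖ ↥N → ∀ i, 1 ≤ i → i ≤ k - 1 →
        extVanish Λ Λᵐᵒᵖ Λ (ModuleCat.of Λ (ExtU Λᵐᵒᵖ Λ Λ N (i + 1))) (i - 1)),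
      (∀ i, 1 ≤ i → i ≤ k → ∀ B : ModuleCat.{0} Λᵐᵒᵖ, Module.Finite Λᵐᵒᵖ ↥B →
        (IsSyzygy Λᵐᵒᵖ i B ↔ Torsionfree Λᵐᵒᵖ Λ Λ i B)) ].TFAE := by
  obtain ⟨k, rfl⟩ : ∃ k', k = k' + 1 := ⟨k - 1, by omega⟩
  rw [Nat.add_sub_cancel, C1_iff, C2_iff, C3_iff, C1_iff, C2_iff, C3_iff]
  tfae_have 1 → 6 := fun h n hn => OT_op h n hn
  tfae_have 6 → 5 := fun h => C2_of_OT h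
  tfae_have 5 → 4 := fun h => C1_of_C2 h
  tfae_have 4 → 3 := fun h n hn => OT_op h n hn
  tfae_have 3 → 2 := fun h => C2_of_OT h
  tfae_have 2 → 1 := fun h => C1_of_C2 h
  tfae_finish

end Statement

end GorPaper
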